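/- (Soundness and completeness of SIG for the dynamic semantics) For every LDEL formula φ: ⊢_SIG φ if and only if φ holds at every world of every epistemic model with respect to every game structure under the dynamic semantics ⊨. -/

import Mathlib

namespace GameRuns

/-- An observation model: an equivalence relation on actions for each player. -/
structure ObsModel (I A : Type) where
  rel : I → A → A → Prop
  equiv : ∀ i, Equivalence (rel i)

/-- The data of a game structure: a partial transition function and game information. -/
structure GameData (I A P S : Type) where
  R : S → A → Option S
  O : S → I → Set P

/-- `G` is a game structure w.r.t. the player assignment `pl` and the
distinguished information pieces `pa`. -/
def IsGameStructure {I A P S : Type} (pl : A → I) (pa : A → P) (G : GameData I A P S) : Prop :=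
  Nonempty S ∧
  (∀ s a b, (G.R s a).isSome → (G.R s b).isSome → pl a = pl b) ∧
  (∀ s a, pa a ∈ G.O s (pl a) ↔ (G.R s a).isSome)

/-- The data of an epistemic model w.r.t. a game structure over states `S`. -/
structure EpiData (I A P S : Type) (W : Type) where
  f : W → S
  sim : I → W → W → Prop
  V : W → I → Set P

/-- `M` is an epistemic model w.r.t. the game structure `G`. -/
def IsEpiModel {I A P S W : Type} (G : GameData I A P S) (M : EpiData I A P S W) : Prop :=
  Nonempty W ∧
  (∀ i, Equivalence (M.sim i)) ∧
  (∀ i w v, M.sim i w v → G.O (M.f w) i = G.O (M.f v) i) ∧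
  (∀ w i, M.V w i = G.O (M.f w) i)

variable {I A P S : Type}

/-- Carrier of the update product `M ⊗ U`. -/
abbrev UpdW (G : GameData I A P S) {W : Type} (M : EpiData I A P S W) : Type :=
  {x : W × A // (G.R (M.f x.1) x.2).isSome}

/-- The update product `M ⊗ U`. -/
def update (G : GameData I A P S) (U : ObsModel I A) {W : Type} (M : EpiData I A P S W) :
    EpiData I A P S (UpdW G M) where
  f x := (G.R (M.f x.val.1) x.val.2).get x.prop
  sim i x y := M.sim i x.val.1 y.val.1 ∧ U.rel i x.val.2 y.val.2 ∧
    G.O ((G.R (M.f x.val.1) x.val.2).get x.prop) i =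
      G.O ((G.R (M.f y.val.1) y.val.2).get y.prop) i
  V x i := G.O ((G.R (M.f x.val.1) x.val.2).get x.prop) i

/-- The data of an epistemic temporal model. -/
structure ETLData (I A P : Type) (W : Type) where
  sim : I → W → W → Prop
  trans : A → W → W → Prop
  V : W → I → Set P

/-- `N` is an epistemic temporal model: nonempty carrier, equivalence relations. -/
def IsETL {W : Type} (N : ETLData I A P W) : Prop :=
  Nonempty W ∧ ∀ i, Equivalence (N.sim i)

/-- The set of actions available at a state of an epistemic temporal model. -/
def Act {W : Type} (N : ETLData I A P W) (s : W) : Set A := {a | ∃ t, N.trans a s t}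

/-- Normality of an epistemic temporal model w.r.t. an observation model:
no miracles, perfect recall, determinism, exclusive turns, info and knowledge of
own information. -/
def Normal (pl : A → I) (pa : A → P) (U : ObsModel I A) {W : Type}
    (N : ETLData I A P W) : Prop :=
  (∀ i a b s s' t t', N.sim i s s' → N.trans a s' t' → N.trans b s t →
      U.rel i b a → N.V t i = N.V t' i → N.sim i t t') ∧
  (∀ i a s t t', N.trans a s t → N.sim i t t' →
      ∃ s' b, N.sim i s s' ∧ U.rel i a b ∧ N.trans b s' t') ∧
  (∀ a s t t', N.trans a s t → N.trans a s t' → t = t') ∧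
  (∀ s : W, (Act N s).Nonempty → ∃ j, ∀ a ∈ Act N s, pl a = j) ∧
  (∀ s a, pa a ∈ N.V s (pl a) ↔ ∃ t, N.trans a s t) ∧
  (∀ i w v, N.sim i w v → N.V w i = N.V v i)

/-- A bundled epistemic model (carrier together with the model). -/
structure BEpi (I A P S : Type) where
  W : Type
  M : EpiData I A P S W

/-- Bundled update. -/
def bUpdate (G : GameData I A P S) (U : ObsModel I A) (B : BEpi I A P S) : BEpi I A P S :=
  ⟨UpdW G B.M, update G U B.M⟩

/-- Iterated update `M ⊗ U^k`. -/
def iter (G : GameData I A P S) (U : ObsModel I A) (B : BEpi I A P S) : ℕ → BEpi I A P S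
  | 0 => B
  | k + 1 => bUpdate G U (iter G U B k)

/-- Carrier of the run model generated by repeatedly updating `U`:
states of level `k` are the states of `M ⊗ U^k`. -/
abbrev RunW (G : GameData I A P S) (U : ObsModel I A) (B : BEpi I A P S) : Type :=
  Σ k : ℕ, (iter G U B k).W

/-- The successor state `(w, a)` of `w` in the next level of the run model. -/
def stepUp (G : GameData I A P S) (U : ObsModel I A) (B : BEpi I A P S) (k : ℕ)
    (w : (iter G U B k).W) (a : A) (h : (G.R ((iter G U B k).M.f w) a).isSome) :
    (iter G U B (k + 1)).W :=
  ⟨(w, a), h⟩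

/-- Epistemic relation of the run model. -/
def runSim (G : GameData I A P S) (U : ObsModel I A) (B : BEpi I A P S) (i : I) :
    RunW G U B → RunW G U B → Prop := fun x y =>
  ∃ h : x.1 = y.1,
    (iter G U B y.1).M.sim i (cast (congrArg (fun k => (iter G U B k).W) h) x.2) y.2

/-- Action relation of the run model. -/
def runTrans (G : GameData I A P S) (U : ObsModel I A) (B : BEpi I A P S) (a : A) :
    RunW G U B → RunW G U B → Prop := fun x y =>
  ∃ h : (G.R ((iter G U B x.1).M.f x.2) a).isSome,
    y = ⟨x.1 + 1, stepUp G U B x.1 x.2 a h⟩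

/-- The run model `F⊗(M)` generated by repeatedly updating `U`. -/
def runModel (G : GameData I A P S) (U : ObsModel I A) (B : BEpi I A P S) :
    ETLData I A P (RunW G U B) where
  sim := runSim G U B
  trans := runTrans G U B
  V x i := (iter G U B x.1).M.V x.2 i

/-- The induced state assignment function of the run model. -/
def runF (G : GameData I A P S) (U : ObsModel I A) (B : BEpi I A P S) :
    RunW G U B → S := fun x => (iter G U B x.1).M.f x.2



section More
variable {I A P S : Type}

/-- The state reached by following a list of actions from `s`, if it exists. -/
def runPath (G : GameData I A P S) : S → List A → Option S
  | s, [] => some s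
  | s, a :: l => (G.R s a).bind fun t => runPath G t l

theorem runPath_append (G : GameData I A P S) (s : S) (l : List A) (a : A) :
    runPath G s (l ++ [a]) = (runPath G s l).bind fun t => G.R t a := by
  induction l generalizing s with
  | nil => simp [runPath]
  | cons b l ih =>
    simp only [List.cons_append, runPath]
    cases h : G.R s b with
    | none => simp
    | some t => simp [ih]

/-- The initial world and the sequence of actions of a state of the run model. -/
def runActs (G : GameData I A P S) (U : ObsModel I A) (B : BEpi I A P S) :
    (k : ℕ) → (iter G U B k).W → B.W × List A
  | 0, w => (w, [])
  | k + 1, w =>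
      ((runActs G U B k w.val.1).1, (runActs G U B k w.val.1).2 ++ [w.val.2])

theorem runActs_path (G : GameData I A P S) (U : ObsModel I A) (B : BEpi I A P S) :
    ∀ (k : ℕ) (w : (iter G U B k).W),
      runPath G (B.M.f (runActs G U B k w).1) (runActs G U B k w).2 =
        some ((iter G U B k).M.f w) := by
  intro k
  induction k with
  | zero => intro w; rfl
  | succ k ih =>
    intro w
    have h1 := ih w.val.1
    show runPath G _ _ = some ((update G U (iter G U B k).M).f w)
    rw [show runActs G U B (k + 1) w =
        ((runActs G U B k w.val.1).1, (runActs G U B k w.val.1).2 ++ [w.val.2]) from rfl]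
    rw [runPath_append, h1]
    exact (Option.some_get w.prop).symm

/-- Carrier of the epistemic game tree generatedfrom `s`: valid histories. -/
abbrev TreeW (G : GameData I A P S) (s : S) : Type := {l : List A // (runPath G s l).isSome}

/-- The epistemic game tree generated from `s` with perfect recall,
viewed as an epistemic temporal model. -/
def tree (G : GameData I A P S) (s : S) : ETLData I A P (TreeW G s) where
  sim i w u := w.val.length = u.val.length ∧
    ∀ k, (runPath G s (w.val.take k)).map (fun t => G.O t i) =
      (runPath G s (u.val.take k)).map (fun t => G.O t i)
  trans a w u := u.val = w.val ++ [a]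
  V w i := G.O ((runPath G s w.val).get w.prop) i

/-- The tracking function from the run model of a certainty epistemic model to the
epistemic game tree generated from the (common-knowledge) initial state. -/
def tracking (G : GameData I A P S) (U : ObsModel I A) {W : Type} (M : EpiData I A P S W)
    (v : W) (hv : ∀ x : W, x = v) (x : RunW G U ⟨W, M⟩) : TreeW G (M.f v) :=
  ⟨(runActs G U ⟨W, M⟩ x.1 x.2).2, by
    have h : runPath G (M.f (runActs G U ⟨W, M⟩ x.1 x.2).1)
        (runActs G U ⟨W, M⟩ x.1 x.2).2 = some ((iter G U ⟨W, M⟩ x.1).M.f x.2) :=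
      runActs_path G U ⟨W, M⟩ x.1 x.2
    rw [hv (runActs G U ⟨W, M⟩ x.1 x.2).1] at h
    rw [h]
    rfl⟩

/-- `U` is non-informative w.r.t. an epistemic temporal model. -/
def NonInformative (U : ObsModel I A) {W : Type} (N : ETLData I A P W) : Prop :=
  ∀ i a b w u s t, N.trans a w s → N.trans b u t → N.sim i w u →
    ¬ U.rel i a b → N.V s i ≠ N.V t i

/-- Isomorphism of epistemic temporal models. -/
def IsIso {W W' : Type} (N : ETLData I A P W) (N' : ETLData I A P W') (g : W → W') : Prop :=
  Function.Bijective g ∧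
  (∀ i x y, N.sim i x y ↔ N'.sim i (g x) (g y)) ∧
  (∀ a x y, N.trans a x y ↔ N'.trans a (g x) (g y)) ∧
  (∀ x i, N.V x i = N'.V (g x) i)

/-- p-morphisms between epistemic temporal models. -/
def IsPMorphism {W W' : Type} (N : ETLData I A P W) (N' : ETLData I A P W')
    (g : W → W') : Prop :=
  (∀ w i, N.V w i = N'.V (g w) i) ∧
  (∀ i w u, N.sim i w u → N'.sim i (g w) (g u)) ∧
  (∀ i w s, N'.sim i (g w) s → ∃ v, g v = s ∧ N.sim i w v) ∧
  (∀ a w u, N.trans a w u → N'.trans a (g w) (g u)) ∧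
  (∀ a w s, N'.trans a (g w) s → ∃ v, g v = s ∧ N.trans a w v)

/-- The induced epistemic game structure `E(G)`, viewed as an epistemic temporal model. -/
def egame (G : GameData I A P S) : ETLData I A P S where
  sim i s t := G.O s i = G.O t i
  trans a s t := G.R s a = some t
  V s i := G.O s i

/-- `G` is a perfect information game: the induced epistemic relations are the identity. -/
def PerfectInfo (G : GameData I A P S) : Prop :=
  ∀ i s t, G.O s i = G.O t i → s = t

/-- The game induced by an epistemic temporal model: `R(s,a) = t` iff `s →_a t`. -/
noncomputable def inducedGame {W : Type} (N : ETLData I A P W) : GameData I A P W where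
  R s a := @dite _ (∃ t, N.trans a s t) (Classical.propDecidable _)
    (fun h => some h.choose) (fun _ => none)
  O := N.V

/-- The epistemic part induced by an epistemic temporal model. -/
def epiPart {W : Type} (N : ETLData I A P W) : EpiData I A P W W where
  f := id
  sim := N.sim
  V := N.V

theorem inducedGame_isSome {W : Type} (N : ETLData I A P W) {a : A} {s t : W}
    (h : N.trans a s t) : ((inducedGame N).R s a).isSome := by
  show (@dite _ (∃ t, N.trans a s t) (Classical.propDecidable _)
    (fun h => some h.choose) (fun _ => none)).isSome
  rw [dif_pos ⟨t, h⟩]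
  rfl

end More
section Lang
variable {I A P S : Type}

/-- The dynamic epistemic language LDEL. -/
inductive LDEL (I A P : Type) : Type where
  | top : LDEL I A P
  | atom : P → I → LDEL I A P
  | neg : LDEL I A P → LDEL I A P
  | conj : LDEL I A P → LDEL I A P → LDEL I A P
  | know : I → LDEL I A P → LDEL I A P
  | box : A → LDEL I A P → LDEL I A P

/-- Implication, defined from negation and conjunction. -/
def impF (φ ψ : LDEL I A P) : LDEL I A P := .neg (.conj φ (.neg ψ))

/-- Disjunction. -/
def orF (φ ψ : LDEL I A P) : LDEL I A P := .neg (.conj (.neg φ) (.neg ψ))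

/-- Biconditional. -/
def iffF (φ ψ : LDEL I A P) : LDEL I A P := .conj (impF φ ψ) (impF ψ φ)

/-- Diamond `⟨a⟩φ`. -/
def diaF (a : A) (φ : LDEL I A P) : LDEL I A P := .neg (.box a (.neg φ))

/-- The dual knowledge modality `K̂_i φ`. -/
def khatF (i : I) (φ : LDEL I A P) : LDEL I A P := .neg (.know i (.neg φ))

/-- Finite conjunction. -/
def bigAnd : List (LDEL I A P) → LDEL I A P
  | [] => .top
  | φ :: l => .conj φ (bigAnd l)

/-- Finite disjunction. -/
def bigOr : List (LDEL I A P) → LDEL I A P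
  | [] => .neg .top
  | φ :: l => orF φ (bigOr l)

/-- The characteristic formula `φ^o_i` of a combination of information pieces,
where `L1` enumerates the pieces in `B` and `L2` those not in `B`. -/
def charF (i : I) (L1 L2 : List P) : LDEL I A P :=
  .conj (bigAnd (L1.map (fun p => LDEL.atom p i)))
    (bigAnd (L2.map (fun p => LDEL.neg (LDEL.atom p i))))

/-- `TURN_i`, given an enumeration `l` of the actions of player `i`. -/
def turnF (l : List A) : LDEL I A P := bigOr (l.map (fun a => diaF a LDEL.top))

/-- Propositional evaluation treating atoms, `K_i ψ` and `[a]ψ` as atomic. -/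
def propEval (v : LDEL I A P → Prop) : LDEL I A P → Prop
  | .top => True
  | .neg φ => ¬ propEval v φ
  | .conj φ ψ => propEval v φ ∧ propEval v ψ
  | φ => v φ

/-- The dynamic (DEL-style) semantics `⊨` over epistemic models w.r.t. a game structure. -/
def dynSat (G : GameData I A P S) (U : ObsModel I A) :
    LDEL I A P → (W : Type) → EpiData I A P S W → W → Prop
  | .top, _, _, _ => True
  | .atom p i, _, M, w => p ∈ M.V w i
  | .neg φ, W, M, w => ¬ dynSat G U φ W M w
  | .conj φ ψ, W, M, w => dynSat G U φ W M w ∧ dynSat G U ψ W M w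
  | .know i φ, W, M, w => ∀ v, M.sim i w v → dynSat G U φ W M v
  | .box a φ, _, M, w => ∀ h : (G.R (M.f w) a).isSome,
      dynSat G U φ (UpdW G M) (update G U M) ⟨(w, a), h⟩

/-- The epistemic temporal (ETL-style) semantics `⊩`. -/
def etlSat {W : Type} (N : ETLData I A P W) : LDEL I A P → W → Prop
  | .top, _ => True
  | .atom p i, w => p ∈ N.V w i
  | .neg φ, w => ¬ etlSat N φ w
  | .conj φ ψ, w => etlSat N φ w ∧ etlSat N ψ w
  | .know i φ, w => ∀ v, N.sim i w v → etlSat N φ v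
  | .box a φ, w => ∀ v, N.trans a w v → etlSat N φ v

/-- `Z` is a `G`-bisimulation between two epistemic models w.r.t. `G`. -/
def IsGBisim {W W' : Type} (G : GameData I A P S) (M : EpiData I A P S W)
    (N : EpiData I A P S W') (Z : W → W' → Prop) : Prop :=
  ∀ w u, Z w u →
    M.f w = N.f u ∧
    (∀ i w', M.sim i w w' → ∃ u', N.sim i u u' ∧ Z w' u') ∧
    (∀ i u', N.sim i u u' → ∃ w', M.sim i w w' ∧ Z w' u')

/-- Pointed `G`-bisimilarity. -/
def GBisimilar {W W' : Type} (G : GameData I A P S) (M : EpiData I A P S W)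
    (N : EpiData I A P S W') (w : W) (u : W') : Prop :=
  ∃ Z, IsGBisim G M N Z ∧ Z w u

/-- The proof system SIG. -/
inductive SIG (pl : A → I) (pa : A → P) (U : ObsModel I A) : LDEL I A P → Prop where
  | taut {φ : LDEL I A P} : (∀ v, propEval v φ) → SIG pl pa U φ
  | distK (i : I) (φ ψ : LDEL I A P) :
      SIG pl pa U (impF (.know i (impF φ ψ)) (impF (.know i φ) (.know i ψ)))
  | distB (a : A) (φ ψ : LDEL I A P) :
      SIG pl pa U (impF (.box a (impF φ ψ)) (impF (.box a φ) (.box a ψ)))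
  | axT (i : I) (φ : LDEL I A P) : SIG pl pa U (impF (.know i φ) φ)
  | ax4 (i : I) (φ : LDEL I A P) :
      SIG pl pa U (impF (.know i φ) (.know i (.know i φ)))
  | ax5 (i : I) (φ : LDEL I A P) :
      SIG pl pa U (impF (.neg (.know i φ)) (.know i (.neg (.know i φ))))
  | nm (i : I) (a b : A) (φ : LDEL I A P) (B : Set P) (L1 L2 : List P)
      (h1 : ∀ p, p ∈ L1 ↔ p ∈ B) (h2 : ∀ p, p ∈ L2 ↔ p ∉ B) (hab : U.rel i a b) :
      SIG pl pa U (impF (khatF i (diaF b (.conj φ (charF i L1 L2))))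
        (.box a (impF (charF i L1 L2) (khatF i φ))))
  | pr (i : I) (a : A) (φ : LDEL I A P) (L : List A) (hL : ∀ b, b ∈ L ↔ U.rel i a b) :
      SIG pl pa U (impF (diaF a (khatF i φ))
        (bigOr (L.map (fun b => khatF i (diaF b φ)))))
  | det (a : A) (φ : LDEL I A P) : SIG pl pa U (impF (diaF a φ) (.box a φ))
  | exturn (i : I) (LA : I → List A) (hLA : ∀ j a, a ∈ LA j ↔ pl a = j)
      (LI : List I) (hLI : ∀ j, j ∈ LI ↔ j ≠ i) :
      SIG pl pa U (impF (turnF (LA i))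
        (bigAnd (LI.map (fun j => LDEL.neg (turnF (LA j))))))
  | info (a : A) : SIG pl pa U (iffF (diaF a .top) (.atom (pa a) (pl a)))
  | ke (p : P) (i : I) :
      SIG pl pa U (.conj (impF (.atom p i) (.know i (.atom p i)))
        (impF (.neg (.atom p i)) (.know i (.neg (.atom p i)))))
  | mp {φ ψ : LDEL I A P} : SIG pl pa U (impF φ ψ) → SIG pl pa U φ → SIG pl pa U ψ
  | necK (i : I) {φ : LDEL I A P} : SIG pl pa U φ → SIG pl pa U (.know i φ)
  | necB (a : A) {φ : LDEL I A P} : SIG pl pa U φ → SIG pl pa U (.box a φ)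

/-- A set of formulas is SIG-inconsistent if the negation of the conjunction of some
finite list of its members is derivable. -/
def Inconsistent (pl : A → I) (pa : A → P) (U : ObsModel I A)
    (Γ : Set (LDEL I A P)) : Prop :=
  ∃ L : List (LDEL I A P), (∀ φ ∈ L, φ ∈ Γ) ∧ SIG pl pa U (.neg (bigAnd L))

/-- Maximally SIG-consistent sets. -/
def MCS (pl : A → I) (pa : A → P) (U : ObsModel I A) (Γ : Set (LDEL I A P)) : Prop :=
  ¬ Inconsistent pl pa U Γ ∧ ∀ Δ, Γ ⊂ Δ → Inconsistent pl pa U Δ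

/-- Carrier of the canonical model: all maximally consistent sets. -/
abbrev CanW (pl : A → I) (pa : A → P) (U : ObsModel I A) : Type :=
  {Γ : Set (LDEL I A P) // MCS pl pa U Γ}

/-- The canonical model of SIG. -/
def canonical (pl : A → I) (pa : A → P) (U : ObsModel I A) :
    ETLData I A P (CanW pl pa U) where
  sim i w u := ∀ φ, LDEL.know i φ ∈ w.val → φ ∈ u.val
  trans a w u := ∀ φ, LDEL.box a φ ∈ w.val → φ ∈ u.val
  V w i := {p | LDEL.atom p i ∈ w.val}

end Lang

section PropositionalReasoning
variable {I A P : Type} {pl : A → I} {pa : A → P} {U : ObsModel I A}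

theorem propEval_impF (v : LDEL I A P → Prop) (φ ψ : LDEL I A P) :
    propEval v (impF φ ψ) ↔ (propEval v φ → propEval v ψ) := by
  simp only [impF, propEval]
  tauto

theorem propEval_bigAnd (v : LDEL I A P → Prop) (L : List (LDEL I A P)) :
    propEval v (bigAnd L) ↔ ∀ φ ∈ L, propEval v φ := by
  induction L with
  | nil => simp [bigAnd, propEval]
  | cons φ L ih => simp [bigAnd, propEval, ih]

/-- Derivability is closed under propositional consequence of one premise. -/
theorem SIG.of_propEval {φ ψ : LDEL I A P} (h : SIG pl pa U φ)
    (ht : ∀ v, propEval v φ → propEval v ψ) : SIG pl pa U ψ :=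
  .mp (.taut fun v => (propEval_impF v _ _).2 (ht v)) h

/-- Derivability is closed under propositional consequence of two premises. -/
theorem SIG.of_propEval₂ {φ ψ χ : LDEL I A P} (h : SIG pl pa U φ) (h' : SIG pl pa U ψ)
    (ht : ∀ v, propEval v φ → propEval v ψ → propEval v χ) : SIG pl pa U χ :=
  .mp (h.of_propEval fun v hv => (propEval_impF v _ _).2 (ht v hv)) h'

end PropositionalReasoning

section Soundness
variable {I A P S : Type}

theorem propEval_dynSat (G : GameData I A P S) (U : ObsModel I A) {W : Type}
    (M : EpiData I A P S W) (w : W) (φ : LDEL I A P) :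
    propEval (fun ψ => dynSat G U ψ W M w) φ ↔ dynSat G U φ W M w := by
  induction φ with
  | neg φ ih => simp only [propEval, dynSat, ih]
  | conj φ ψ ih₁ ih₂ => simp only [propEval, dynSat, ih₁, ih₂]
  | _ => simp only [propEval, dynSat]

section Connectives
variable (G : GameData I A P S) (U : ObsModel I A) {W : Type} (M : EpiData I A P S W) (w : W)

theorem dynSat_impF (φ ψ : LDEL I A P) :
    dynSat G U (impF φ ψ) W M w ↔ (dynSat G U φ W M w → dynSat G U ψ W M w) := by
  simp only [impF, dynSat]
  tauto

theorem dynSat_iffF (φ ψ : LDEL I A P) :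
    dynSat G U (iffF φ ψ) W M w ↔ (dynSat G U φ W M w ↔ dynSat G U ψ W M w) := by
  simp only [iffF, dynSat, dynSat_impF]
  tauto

theorem dynSat_khatF (i : I) (φ : LDEL I A P) :
    dynSat G U (khatF i φ) W M w ↔ ∃ v, M.sim i w v ∧ dynSat G U φ W M v := by
  simp [khatF, dynSat]

theorem dynSat_diaF (a : A) (φ : LDEL I A P) :
    dynSat G U (diaF a φ) W M w ↔ ∃ h : (G.R (M.f w) a).isSome,
      dynSat G U φ (UpdW G M) (update G U M) ⟨(w, a), h⟩ := by
  simp [diaF, dynSat]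

theorem dynSat_bigAnd (L : List (LDEL I A P)) :
    dynSat G U (bigAnd L) W M w ↔ ∀ φ ∈ L, dynSat G U φ W M w := by
  induction L with
  | nil => simp [bigAnd, dynSat]
  | cons φ L ih => simp [bigAnd, dynSat, ih]

theorem dynSat_bigOr (L : List (LDEL I A P)) :
    dynSat G U (bigOr L) W M w ↔ ∃ φ ∈ L, dynSat G U φ W M w := by
  induction L with
  | nil => simp [bigOr, dynSat]
  | cons φ L ih =>
    simp only [bigOr, orF, dynSat, ih, List.mem_cons, exists_eq_or_imp]
    rw [not_and_or, not_not, not_not]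

theorem dynSat_turnF (L : List A) :
    dynSat G U (turnF L) W M w ↔ ∃ a ∈ L, (G.R (M.f w) a).isSome := by
  simp [turnF, dynSat_bigOr, dynSat_diaF, dynSat]

theorem dynSat_charF (i : I) {B : Set P} {L₁ L₂ : List P} (h₁ : ∀ p, p ∈ L₁ ↔ p ∈ B)
    (h₂ : ∀ p, p ∈ L₂ ↔ p ∉ B) :
    dynSat G U (charF i L₁ L₂) W M w ↔ M.V w i = B := by
  simp only [charF, dynSat, dynSat_bigAnd, List.forall_mem_map, h₁, h₂, Set.ext_iff]
  exact ⟨fun h p => ⟨fun hp => by_contra fun hB => h.2 p hB hp, h.1 p⟩,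
    fun h => ⟨fun p => (h p).2, fun p hp hV => hp ((h p).1 hV)⟩⟩

end Connectives

/-- A nonempty update product of an epistemic model is an epistemic model. -/
theorem IsEpiModel.update {G : GameData I A P S} (U : ObsModel I A) {W : Type}
    {M : EpiData I A P S W} (hM : IsEpiModel G M) (x : UpdW G M) :
    IsEpiModel G (update G U M) := by
  obtain ⟨-, hE, -, -⟩ := hM
  refine ⟨⟨x⟩, fun i => ⟨fun y => ⟨(hE i).refl _, (U.equiv i).refl _, rfl⟩, ?_, ?_⟩, ?_, ?_⟩
  · exact fun h => ⟨(hE i).symm h.1, (U.equiv i).symm h.2.1, h.2.2.symm⟩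
  · exact fun h h' => ⟨(hE i).trans h.1 h'.1, (U.equiv i).trans h.2.1 h'.2.1,
      h.2.2.trans h'.2.2⟩
  · exact fun i y z h => h.2.2
  · exact fun y i => rfl

/-- Derivable formulas are valid for the dynamic semantics. -/
theorem SIG.sound {pl : A → I} {pa : A → P} {U : ObsModel I A} {φ : LDEL I A P}
    (h : SIG pl pa U φ) {G : GameData I A P S} (hG : IsGameStructure pl pa G) :
    ∀ {W : Type} {M : EpiData I A P S W}, IsEpiModel G M → ∀ w, dynSat G U φ W M w := by
  induction h with
  | taut h => exact fun {W M} _ w => (propEval_dynSat G U M w _).1 (h _)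
  | distK i φ ψ =>
    intro W M hM w
    simp only [dynSat_impF, dynSat]
    exact fun h h' v hv => h v hv (h' v hv)
  | distB a φ ψ =>
    intro W M hM w
    simp only [dynSat_impF, dynSat]
    exact fun h h' hs => h hs (h' hs)
  | axT i φ =>
    intro W M hM w
    simp only [dynSat_impF, dynSat]
    exact fun h => h w ((hM.2.1 i).refl w)
  | ax4 i φ =>
    intro W M hM w
    simp only [dynSat_impF, dynSat]
    exact fun h v hv u hu => h u ((hM.2.1 i).trans hv hu)
  | ax5 i φ =>
    intro W M hM w
    simp only [dynSat_impF, dynSat]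
    exact fun h v hv h' => h fun u hu => h' u ((hM.2.1 i).trans ((hM.2.1 i).symm hv) hu)
  | nm i a b φ B L₁ L₂ h₁ h₂ hab =>
    intro W M hM w
    simp only [dynSat_impF, dynSat, dynSat_khatF, dynSat_diaF, dynSat_charF G U _ _ i h₁ h₂]
    rintro ⟨v, hv, hb, hφ, hB⟩ ha hB'
    exact ⟨⟨(v, b), hb⟩, ⟨hv, hab, hB'.trans hB.symm⟩, hφ⟩
  | pr i a φ L hL =>
    intro W M hM w
    simp only [dynSat_impF, dynSat_khatF, dynSat_diaF, dynSat_bigOr, List.mem_map,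
      exists_exists_and_eq_and]
    rintro ⟨ha, ⟨⟨v, b⟩, hb⟩, hv, hφ⟩
    exact ⟨b, (hL b).2 hv.2.1, v, hv.1, hb, hφ⟩
  | det a φ =>
    intro W M hM w
    simp only [dynSat_impF, dynSat, dynSat_diaF]
    exact fun h _ => h.2
  | exturn i LA hLA LI hLI =>
    intro W M hM w
    simp only [dynSat_impF, dynSat, dynSat_bigAnd, dynSat_turnF, List.forall_mem_map, hLA, hLI]
    rintro ⟨a, rfl, ha⟩ j hj ⟨b, rfl, hb⟩
    exact hj (hG.2.1 _ _ _ hb ha)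
  | info a =>
    intro W M hM w
    simp only [dynSat_iffF, dynSat_diaF, dynSat, exists_prop, and_true, hM.2.2.2]
    exact (hG.2.2 _ a).symm
  | ke p i =>
    intro W M hM w
    simp only [dynSat_impF, dynSat, hM.2.2.2]
    exact ⟨fun h v hv => hM.2.2.1 i w v hv ▸ h, fun h v hv => hM.2.2.1 i w v hv ▸ h⟩
  | mp _ _ ih ih' =>
    exact fun {W M} hM w => (dynSat_impF G U M w _ _).1 (ih hM w) (ih' hM w)
  | necK i _ ih => exact fun {W M} hM w v _ => ih hM v
  | necB a _ ih => exact fun {W M} hM w h => ih (hM.update U ⟨(w, a), h⟩) _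

end Soundness

section MaximalConsistentSets
variable {I A P : Type} {pl : A → I} {pa : A → P} {U : ObsModel I A} {Γ : Set (LDEL I A P)}

theorem MCS.exists_list_of_notMem (hΓ : MCS pl pa U Γ) {φ : LDEL I A P} (hφ : φ ∉ Γ) :
    ∃ L : List (LDEL I A P), (∀ ψ ∈ L, ψ ∈ Γ) ∧ SIG pl pa U (impF (bigAnd L) (.neg φ)) := by
  classical
  obtain ⟨L, hL, hS⟩ := hΓ.2 _ (Set.ssubset_insert hφ)
  refine ⟨L.filter (· ≠ φ), fun ψ hψ => ?_, hS.of_propEval fun v hv => ?_⟩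
  · have hψ' := List.mem_filter.1 hψ
    exact (hL ψ hψ'.1).resolve_left (by simpa using hψ'.2)
  · simp only [propEval_impF, propEval, propEval_bigAnd] at hv ⊢
    intro h hφ'
    refine hv fun ψ hψ => ?_
    by_cases e : ψ = φ
    · exact e ▸ hφ'
    · exact h ψ (List.mem_filter.2 ⟨hψ, by simpa using e⟩)

/-- A maximally consistent set is deductively closed. -/
theorem MCS.mem_of_list (hΓ : MCS pl pa U Γ) {L : List (LDEL I A P)} {φ : LDEL I A P}
    (hL : ∀ ψ ∈ L, ψ ∈ Γ) (h : SIG pl pa U (impF (bigAnd L) φ)) : φ ∈ Γ := by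
  by_contra hφ
  obtain ⟨L', hL', h'⟩ := hΓ.exists_list_of_notMem hφ
  refine hΓ.1 ⟨L ++ L', fun ψ hψ => ?_, h.of_propEval₂ h' fun v hv hv' => ?_⟩
  · exact (List.mem_append.1 hψ).elim (hL ψ) (hL' ψ)
  · simp only [propEval_impF, propEval, propEval_bigAnd, List.mem_append] at *
    exact fun hA => hv' (fun ψ hψ => hA ψ (.inr hψ)) (hv fun ψ hψ => hA ψ (.inl hψ))

theorem MCS.mem_of_SIG (hΓ : MCS pl pa U Γ) {φ : LDEL I A P} (h : SIG pl pa U φ) : φ ∈ Γ :=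
  hΓ.mem_of_list (L := []) (by simp)
    (h.of_propEval fun v hv => (propEval_impF v _ _).2 fun _ => hv)

theorem MCS.neg_mem (hΓ : MCS pl pa U Γ) (φ : LDEL I A P) : LDEL.neg φ ∈ Γ ↔ φ ∉ Γ := by
  refine ⟨fun h h' => hΓ.1 ⟨[φ, .neg φ], by simp [h, h'], .taut fun v => ?_⟩, fun h => ?_⟩
  · simp [bigAnd, propEval]
  · obtain ⟨L, hL, hS⟩ := hΓ.exists_list_of_notMem h
    exact hΓ.mem_of_list hL hS

theorem MCS.conj_mem (hΓ : MCS pl pa U Γ) (φ ψ : LDEL I A P) :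
    LDEL.conj φ ψ ∈ Γ ↔ φ ∈ Γ ∧ ψ ∈ Γ := by
  refine ⟨fun h => ⟨?_, ?_⟩, fun h => ?_⟩
  · refine hΓ.mem_of_list (L := [.conj φ ψ]) (by simpa using h) (.taut fun v => ?_)
    simp +contextual [propEval_impF, bigAnd, propEval]
  · refine hΓ.mem_of_list (L := [.conj φ ψ]) (by simpa using h) (.taut fun v => ?_)
    simp +contextual [propEval_impF, bigAnd, propEval]
  · refine hΓ.mem_of_list (L := [φ, ψ]) (by simpa using h) (.taut fun v => ?_)
    simp +contextual [propEval_impF, bigAnd, propEval]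

theorem MCS.top_mem (hΓ : MCS pl pa U Γ) : LDEL.top ∈ Γ :=
  hΓ.mem_of_SIG (.taut fun v => by simp [propEval])

theorem MCS.impF_mem (hΓ : MCS pl pa U Γ) (φ ψ : LDEL I A P) :
    impF φ ψ ∈ Γ ↔ (φ ∈ Γ → ψ ∈ Γ) := by
  simp only [impF, hΓ.neg_mem, hΓ.conj_mem]
  tauto

theorem MCS.bigAnd_mem (hΓ : MCS pl pa U Γ) (L : List (LDEL I A P)) :
    bigAnd L ∈ Γ ↔ ∀ φ ∈ L, φ ∈ Γ := by
  induction L with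
  | nil => simp [bigAnd, hΓ.top_mem]
  | cons φ L ih => simp [bigAnd, hΓ.conj_mem, ih]

theorem MCS.bigOr_mem (hΓ : MCS pl pa U Γ) (L : List (LDEL I A P)) :
    bigOr L ∈ Γ ↔ ∃ φ ∈ L, φ ∈ Γ := by
  induction L with
  | nil => simp [bigOr, hΓ.neg_mem, hΓ.top_mem]
  | cons φ L ih =>
    simp only [bigOr, orF, hΓ.neg_mem, hΓ.conj_mem, ih, List.mem_cons, exists_eq_or_imp]
    rw [not_and_or, not_not, not_not]

theorem MCS.charF_mem (hΓ : MCS pl pa U Γ) (i : I) {B : Set P} {L₁ L₂ : List P}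
    (h₁ : ∀ p, p ∈ L₁ ↔ p ∈ B) (h₂ : ∀ p, p ∈ L₂ ↔ p ∉ B) :
    charF i L₁ L₂ ∈ Γ ↔ {p | LDEL.atom p i ∈ Γ} = B := by
  simp only [charF, hΓ.conj_mem, hΓ.bigAnd_mem, hΓ.neg_mem, List.forall_mem_map, h₁, h₂,
    Set.ext_iff, Set.mem_ofPred_eq]
  exact ⟨fun h p => ⟨fun hp => by_contra fun hB => h.2 p hB hp, h.1 p⟩,
    fun h => ⟨fun p => (h p).2, fun p hp hV => hp ((h p).1 hV)⟩⟩

theorem MCS.eq_of_subset {Δ : Set (LDEL I A P)} (hΓ : MCS pl pa U Γ) (hΔ : MCS pl pa U Δ)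
    (h : Γ ⊆ Δ) : Γ = Δ :=
  h.antisymm fun φ hφ => by_contra fun hn =>
    (hΔ.neg_mem φ).1 (h ((hΓ.neg_mem φ).2 hn)) hφ

/-- Lindenbaum's lemma. -/
theorem exists_MCS_superset (hΓ : ¬ Inconsistent pl pa U Γ) : ∃ Δ, MCS pl pa U Δ ∧ Γ ⊆ Δ := by
  obtain ⟨Δ, hΓΔ, hΔ⟩ := zorn_subset_nonempty {X | ¬ Inconsistent pl pa U X} (by
    intro c hc hch hne
    refine ⟨⋃₀ c, ?_, fun X hX => Set.subset_sUnion_of_mem hX⟩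
    rintro ⟨L, hL, hS⟩
    have key : ∀ L : List (LDEL I A P), (∀ φ ∈ L, φ ∈ ⋃₀ c) → ∃ X ∈ c, ∀ φ ∈ L, φ ∈ X := by
      intro L
      induction L with
      | nil => exact fun _ => ⟨hne.some, hne.some_mem, by simp⟩
      | cons φ L ih =>
        intro h
        obtain ⟨X, hX, hXL⟩ := ih fun ψ hψ => h ψ (List.mem_cons_of_mem _ hψ)
        obtain ⟨Y, hY, hYφ⟩ := h φ List.mem_cons_self
        rcases hch.total hX hY with hXY | hYX
        · exact ⟨Y, hY, List.forall_mem_cons.2 ⟨hYφ, fun ψ hψ => hXY (hXL ψ hψ)⟩⟩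
        · exact ⟨X, hX, List.forall_mem_cons.2 ⟨hYX hYφ, hXL⟩⟩
    obtain ⟨X, hX, hXL⟩ := key L hL
    exact hc hX ⟨L, hXL, hS⟩) Γ hΓ
  exact ⟨Δ, ⟨hΔ.prop, fun X hX => by_contra fun h => hX.2 (hΔ.le_of_ge h hX.1)⟩, hΓΔ⟩

/-- A formula is derivable iff it belongs to every maximally consistent set. -/
theorem SIG_iff_forall_MCS {φ : LDEL I A P} :
    SIG pl pa U φ ↔ ∀ Γ, MCS pl pa U Γ → φ ∈ Γ := by
  refine ⟨fun h Γ hΓ => hΓ.mem_of_SIG h, fun h => by_contra fun hφ => ?_⟩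
  have hcon : ¬ Inconsistent pl pa U {LDEL.neg φ} := by
    rintro ⟨L, hL, hS⟩
    refine hφ (hS.of_propEval fun v hv => by_contra fun hn => hv ?_)
    refine (propEval_bigAnd v L).2 fun ψ hψ => ?_
    rw [Set.mem_singleton_iff.1 (hL ψ hψ)]
    exact hn
  obtain ⟨Γ, hΓ, hsub⟩ := exists_MCS_superset hcon
  exact (hΓ.neg_mem φ).1 (hsub rfl) (h Γ hΓ)

end MaximalConsistentSets

section NormalModalities
variable {I A P : Type} {pl : A → I} {pa : A → P} {U : ObsModel I A} {Γ : Set (LDEL I A P)}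

/-- A formula operator satisfying distribution and necessitation. -/
structure NormalModality (pl : A → I) (pa : A → P) (U : ObsModel I A)
    (m : LDEL I A P → LDEL I A P) : Prop where
  dist : ∀ φ ψ, SIG pl pa U (impF (m (impF φ ψ)) (impF (m φ) (m ψ)))
  nec : ∀ {φ}, SIG pl pa U φ → SIG pl pa U (m φ)

theorem normalModality_know (i : I) : NormalModality pl pa U (LDEL.know i) :=
  ⟨.distK i, .necK i⟩

theorem normalModality_box (a : A) : NormalModality pl pa U (LDEL.box a) :=
  ⟨.distB a, .necB a⟩

variable {m : LDEL I A P → LDEL I A P}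

theorem NormalModality.mem_mono (hm : NormalModality pl pa U m) (hΓ : MCS pl pa U Γ)
    {φ ψ : LDEL I A P} (h : ∀ Δ, MCS pl pa U Δ → φ ∈ Δ → ψ ∈ Δ) (hφ : m φ ∈ Γ) : m ψ ∈ Γ := by
  have himp : SIG pl pa U (impF φ ψ) :=
    SIG_iff_forall_MCS.2 fun Δ hΔ => (hΔ.impF_mem _ _).2 (h Δ hΔ)
  have hd := hΓ.mem_of_SIG (hm.dist φ ψ)
  simp only [hΓ.impF_mem] at hd
  exact hd (hΓ.mem_of_SIG (hm.nec himp)) hφ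

theorem NormalModality.bigAnd_mem (hm : NormalModality pl pa U m) (hΓ : MCS pl pa U Γ)
    {L : List (LDEL I A P)} (hL : ∀ φ ∈ L, m φ ∈ Γ) : m (bigAnd L) ∈ Γ := by
  induction L with
  | nil => exact hΓ.mem_of_SIG (hm.nec (.taut fun v => by simp [bigAnd, propEval]))
  | cons φ L ih =>
    rw [List.forall_mem_cons] at hL
    have hd := hΓ.mem_of_SIG (hm.dist (bigAnd L) (bigAnd (φ :: L)))
    simp only [hΓ.impF_mem] at hd
    refine hd (hm.mem_mono hΓ (fun Δ hΔ hφ => ?_) hL.1) (ih hL.2)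
    exact (hΔ.impF_mem _ _).2 fun h => (hΔ.conj_mem _ _).2 ⟨hφ, h⟩

/-- If no maximally consistent successor of `Γ` contains `X`, then the failure is witnessed
by finitely many members of `X`. -/
theorem NormalModality.exists_successor_or (hm : NormalModality pl pa U m)
    (hΓ : MCS pl pa U Γ) (X : Set (LDEL I A P)) :
    (∃ Δ, MCS pl pa U Δ ∧ (∀ φ, m φ ∈ Γ → φ ∈ Δ) ∧ X ⊆ Δ) ∨
      ∃ L : List (LDEL I A P), (∀ φ ∈ L, φ ∈ X) ∧ m (.neg (bigAnd L)) ∈ Γ := by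
  classical
  by_cases hcon : Inconsistent pl pa U ({φ | m φ ∈ Γ} ∪ X)
  · right
    obtain ⟨L, hL, hS⟩ := hcon
    refine ⟨L.filter (· ∈ X), fun φ hφ => by simpa using (List.mem_filter.1 hφ).2, ?_⟩
    refine hm.mem_mono (φ := bigAnd (L.filter (· ∉ X))) hΓ (fun Δ hΔ h => ?_)
      (hm.bigAnd_mem hΓ fun φ hφ => ?_)
    · have hS' := hΔ.mem_of_SIG hS
      simp only [hΔ.neg_mem, hΔ.bigAnd_mem, List.mem_filter, decide_eq_true_eq] at hS' h ⊢
      refine fun h' => hS' fun φ hφ => ?_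
      by_cases hX : φ ∈ X
      · exact h' φ ⟨hφ, hX⟩
      · exact h φ ⟨hφ, hX⟩
    · have hφ' := List.mem_filter.1 hφ
      exact (hL φ hφ'.1).resolve_right (by simpa using hφ'.2)
  · obtain ⟨Δ, hΔ, hsub⟩ := exists_MCS_superset hcon
    exact .inl ⟨Δ, hΔ, fun φ hφ => hsub (.inl hφ), fun φ hφ => hsub (.inr hφ)⟩

theorem NormalModality.mem_iff (hm : NormalModality pl pa U m) (hΓ : MCS pl pa U Γ)
    (φ : LDEL I A P) :
    m φ ∈ Γ ↔ ∀ Δ, MCS pl pa U Δ → (∀ ψ, m ψ ∈ Γ → ψ ∈ Δ) → φ ∈ Δ := by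
  refine ⟨fun h Δ _ hs => hs φ h, fun h => ?_⟩
  rcases hm.exists_successor_or hΓ {LDEL.neg φ} with ⟨Δ, hΔ, hs, hX⟩ | ⟨L, hL, hL'⟩
  · exact absurd (h Δ hΔ hs) ((hΔ.neg_mem φ).1 (hX rfl))
  · refine hm.mem_mono hΓ (fun Δ hΔ h' => by_contra fun hn => ?_) hL'
    refine (hΔ.neg_mem _).1 h' ((hΔ.bigAnd_mem L).2 fun ψ hψ => ?_)
    rw [Set.mem_singleton_iff.1 (hL ψ hψ)]
    exact (hΔ.neg_mem φ).2 hn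

theorem NormalModality.neg_neg_mem (hm : NormalModality pl pa U m) (hΓ : MCS pl pa U Γ)
    (φ : LDEL I A P) : m (.neg (.neg φ)) ∈ Γ ↔ m φ ∈ Γ :=
  ⟨hm.mem_mono hΓ fun Δ hΔ h => by simpa [hΔ.neg_mem] using h,
    hm.mem_mono hΓ fun Δ hΔ h => by simpa [hΔ.neg_mem] using h⟩

end NormalModalities

section CanonicalModel
variable {I A P : Type} {pl : A → I} {pa : A → P} {U : ObsModel I A}

/-- The truth lemma for the canonical model. -/
theorem etlSat_canonical (φ : LDEL I A P) :
    ∀ w : CanW pl pa U, etlSat (canonical pl pa U) φ w ↔ φ ∈ w.val := by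
  induction φ with
  | top => exact fun w => by simp [etlSat, w.prop.top_mem]
  | atom p i => exact fun w => Iff.rfl
  | neg φ ih => exact fun w => by simp only [etlSat, ih, w.prop.neg_mem]
  | conj φ ψ ih₁ ih₂ => exact fun w => by simp only [etlSat, ih₁, ih₂, w.prop.conj_mem]
  | know i φ ih =>
    intro w
    rw [(normalModality_know i).mem_iff w.prop]
    simp only [etlSat, ih, Subtype.forall]
    rfl
  | box a φ ih =>
    intro w
    rw [(normalModality_box a).mem_iff w.prop]
    simp only [etlSat, ih, Subtype.forall]
    rfl

theorem canonical_sim_equivalence (i : I) : Equivalence ((canonical pl pa U).sim i) := by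
  have hsymm : ∀ {w u : CanW pl pa U}, (canonical pl pa U).sim i w u →
      (canonical pl pa U).sim i u w := by
    intro w u h φ hφ
    have h5 := w.prop.mem_of_SIG (.ax5 i φ)
    have hT := w.prop.mem_of_SIG (.axT i φ)
    simp only [w.prop.impF_mem, w.prop.neg_mem] at h5 hT
    by_contra hn
    exact (u.prop.neg_mem _).1 (h _ (h5 fun hk => hn (hT hk))) hφ
  refine ⟨fun w φ hφ => ?_, hsymm, fun {w u v} h h' φ hφ => h' φ (h _ ?_)⟩
  · exact (w.prop.impF_mem _ _).1 (w.prop.mem_of_SIG (.axT i φ)) hφ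
  · exact (w.prop.impF_mem _ _).1 (w.prop.mem_of_SIG (.ax4 i φ)) hφ

theorem diaF_mem_of_trans {a : A} {w u : CanW pl pa U} (h : (canonical pl pa U).trans a w u)
    {φ : LDEL I A P} (hφ : φ ∈ u.val) : diaF a φ ∈ w.val :=
  (w.prop.neg_mem _).2 fun hb => (u.prop.neg_mem φ).1 (h _ hb) hφ

theorem khatF_mem_of_sim {i : I} {w u : CanW pl pa U} (h : (canonical pl pa U).sim i w u)
    {φ : LDEL I A P} (hφ : φ ∈ u.val) : khatF i φ ∈ w.val :=
  (w.prop.neg_mem _).2 fun hb => (u.prop.neg_mem φ).1 (h _ hb) hφ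

theorem exists_trans_iff_diaF_mem {a : A} {w : CanW pl pa U} :
    (∃ u, (canonical pl pa U).trans a w u) ↔ diaF a LDEL.top ∈ w.val := by
  refine ⟨fun ⟨u, hu⟩ => diaF_mem_of_trans hu u.prop.top_mem, fun h => ?_⟩
  rw [diaF, w.prop.neg_mem, (normalModality_box a).mem_iff w.prop] at h
  push Not at h
  obtain ⟨Δ, hΔ, hs, -⟩ := h
  exact ⟨⟨Δ, hΔ⟩, hs⟩

theorem canonical_noMiracles [Finite P] {i : I} {a b : A} {s s' t t' : CanW pl pa U}
    (hs : (canonical pl pa U).sim i s s') (ht' : (canonical pl pa U).trans a s' t')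
    (ht : (canonical pl pa U).trans b s t) (hba : U.rel i b a)
    (hV : (canonical pl pa U).V t i = (canonical pl pa U).V t' i) :
    (canonical pl pa U).sim i t t' := by
  intro φ hφ
  by_contra hn
  let B : Set P := {p | LDEL.atom p i ∈ t'.val}
  obtain ⟨L₁, h₁⟩ : ∃ L : List P, ∀ p, p ∈ L ↔ p ∈ B :=
    ⟨B.toFinite.toFinset.toList, by simp⟩
  obtain ⟨L₂, h₂⟩ : ∃ L : List P, ∀ p, p ∈ L ↔ p ∉ B :=
    ⟨Bᶜ.toFinite.toFinset.toList, by simp⟩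
  have hnm := (s.prop.impF_mem _ _).1
    (s.prop.mem_of_SIG (.nm i b a (.neg φ) B L₁ L₂ h₁ h₂ hba))
    (khatF_mem_of_sim hs (diaF_mem_of_trans ht' ((t'.prop.conj_mem _ _).2
      ⟨(t'.prop.neg_mem φ).2 hn, (t'.prop.charF_mem i h₁ h₂).2 rfl⟩)))
  have hk := (t.prop.impF_mem _ _).1 (ht _ hnm) ((t.prop.charF_mem i h₁ h₂).2 hV)
  rw [khatF, t.prop.neg_mem, (normalModality_know i).neg_neg_mem t.prop] at hk
  exact hk hφ

theorem canonical_perfectRecall [Finite A] {i : I} {a : A} {s t t' : CanW pl pa U}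
    (ht : (canonical pl pa U).trans a s t) (hsim : (canonical pl pa U).sim i t t') :
    ∃ s' b, (canonical pl pa U).sim i s s' ∧ U.rel i a b ∧
      (canonical pl pa U).trans b s' t' := by
  by_contra hcon
  have refute : ∀ b, U.rel i a b →
      ∃ ψ ∈ t'.val, LDEL.know i (.neg (diaF b ψ)) ∈ s.val := by
    intro b hb
    rcases (normalModality_know i).exists_successor_or s.prop
      {χ | ∃ ψ ∈ t'.val, diaF b ψ = χ} with ⟨Δ, hΔ, hs, hX⟩ | ⟨L, hL, hL'⟩
    · refine absurd ⟨⟨Δ, hΔ⟩, b, hs, hb, fun φ hφ => by_contra fun hn => ?_⟩ hcon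
      have hd : diaF b (.neg φ) ∈ Δ := hX ⟨_, (t'.prop.neg_mem φ).2 hn, rfl⟩
      rw [diaF, hΔ.neg_mem, (normalModality_box b).neg_neg_mem hΔ] at hd
      exact hd hφ
    · obtain ⟨L', hL't, rfl⟩ : ∃ L' : List (LDEL I A P),
          (∀ ψ ∈ L', ψ ∈ t'.val) ∧ L'.map (diaF b) = L := by
        clear hL'
        induction L with
        | nil => exact ⟨[], by simp⟩
        | cons φ L ih =>
          rw [List.forall_mem_cons] at hL
          obtain ⟨L', h, rfl⟩ := ih hL.2
          obtain ⟨ψ, hψ, rfl⟩ := hL.1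
          exact ⟨ψ :: L', List.forall_mem_cons.2 ⟨hψ, h⟩, rfl⟩
      refine ⟨bigAnd L', (t'.prop.bigAnd_mem L').2 hL't,
        (normalModality_know i).mem_mono s.prop (fun Δ hΔ h => ?_) hL'⟩
      simp only [hΔ.neg_mem, hΔ.bigAnd_mem, List.forall_mem_map] at h
      refine (hΔ.neg_mem _).2 fun hd => h fun ψ hψ => ?_
      simp only [diaF, hΔ.neg_mem] at hd ⊢
      refine fun hb' => hd ((normalModality_box b).mem_mono hΔ (fun Θ hΘ hn => ?_) hb')
      rw [hΘ.neg_mem] at hn ⊢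
      exact fun hA => hn ((hΘ.bigAnd_mem L').1 hA ψ hψ)
  have : Nonempty (LDEL I A P) := ⟨.top⟩
  choose! ψ hψt hψs using refute
  obtain ⟨L, hL⟩ : ∃ L : List A, ∀ b, b ∈ L ↔ U.rel i a b :=
    ⟨(Set.toFinite {b | U.rel i a b}).toFinset.toList, by simp⟩
  have hpr := (s.prop.impF_mem _ _).1
    (s.prop.mem_of_SIG (.pr i a (bigAnd (L.map ψ)) L hL))
    (diaF_mem_of_trans ht (khatF_mem_of_sim hsim ((t'.prop.bigAnd_mem _).2
      (List.forall_mem_map.2 fun b hb => hψt b ((hL b).1 hb)))))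
  simp only [s.prop.bigOr_mem, List.mem_map, exists_exists_and_eq_and] at hpr
  obtain ⟨b, hb, hk⟩ := hpr
  refine (s.prop.neg_mem _).1 hk ((normalModality_know i).mem_mono s.prop
    (fun Δ hΔ h => ?_) (hψs b ((hL b).1 hb)))
  simp only [diaF, hΔ.neg_mem, not_not] at h ⊢
  refine (normalModality_box b).mem_mono hΔ (fun Θ hΘ hn => ?_) h
  rw [hΘ.neg_mem] at hn ⊢
  exact fun hA => hn ((hΘ.bigAnd_mem _).1 hA _ (List.mem_map_of_mem hb))

theorem canonical_deterministic {a : A} {s t t' : CanW pl pa U}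
    (ht : (canonical pl pa U).trans a s t) (ht' : (canonical pl pa U).trans a s t') : t = t' :=
  Subtype.ext (t.prop.eq_of_subset t'.prop fun φ hφ =>
    ht' φ ((s.prop.impF_mem _ _).1 (s.prop.mem_of_SIG (.det a φ)) (diaF_mem_of_trans ht hφ)))

theorem canonical_exclusiveTurns [Finite I] [Finite A] {a b : A} {s : CanW pl pa U}
    (ha : diaF a LDEL.top ∈ s.val) (hb : diaF b LDEL.top ∈ s.val) : pl a = pl b := by
  by_contra hne
  let LA : I → List A := fun j => (Set.toFinite {c | pl c = j}).toFinset.toList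
  have hLA : ∀ j c, c ∈ LA j ↔ pl c = j := by simp [LA]
  let LI : List I := (Set.toFinite {j | j ≠ pl b}).toFinset.toList
  have hLI : ∀ j, j ∈ LI ↔ j ≠ pl b := by simp [LI]
  have h := s.prop.mem_of_SIG (.exturn (pl b) LA hLA LI hLI)
  simp only [s.prop.impF_mem, s.prop.bigAnd_mem, List.forall_mem_map] at h
  simp only [s.prop.neg_mem, turnF, s.prop.bigOr_mem, List.mem_map, exists_exists_and_eq_and,
    hLA, hLI] at h
  exact h ⟨b, rfl, hb⟩ (pl a) hne ⟨a, rfl, ha⟩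

theorem canonical_info (s : CanW pl pa U) (a : A) :
    pa a ∈ (canonical pl pa U).V s (pl a) ↔ ∃ t, (canonical pl pa U).trans a s t := by
  have h := s.prop.mem_of_SIG (.info a)
  simp only [iffF, s.prop.conj_mem, s.prop.impF_mem] at h
  rw [exists_trans_iff_diaF_mem]
  exact ⟨h.2, h.1⟩

theorem canonical_V_eq_of_sim {i : I} {w v : CanW pl pa U} (h : (canonical pl pa U).sim i w v) :
    (canonical pl pa U).V w i = (canonical pl pa U).V v i := by
  ext p
  have hk := w.prop.mem_of_SIG (.ke p i)
  simp only [w.prop.conj_mem, w.prop.impF_mem] at hk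
  refine ⟨fun hp => h _ (hk.1 hp), fun hp => by_contra fun hn => ?_⟩
  exact (v.prop.neg_mem _).1 (h _ (hk.2 ((w.prop.neg_mem _).2 hn))) hp

theorem canonical_normal [Finite I] [Finite A] [Finite P] :
    Normal pl pa U (canonical pl pa U) := by
  refine ⟨fun i a b s s' t t' => canonical_noMiracles, fun i a s t t' => canonical_perfectRecall,
    fun a s t t' => canonical_deterministic, fun s ⟨b, hb⟩ => ⟨pl b, fun a ha => ?_⟩,
    canonical_info, fun i w v => canonical_V_eq_of_sim⟩
  exact canonical_exclusiveTurns (exists_trans_iff_diaF_mem.1 ha) (exists_trans_iff_diaF_mem.1 hb)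

end CanonicalModel

section InducedGame
variable {I A P X : Type} {pl : A → I} {pa : A → P} {U : ObsModel I A} {N : ETLData I A P X}

theorem inducedGame_isSome_iff {a : A} {s : X} :
    ((inducedGame N).R s a).isSome ↔ ∃ t, N.trans a s t := by
  refine ⟨fun h => by_contra fun hn => ?_, fun ⟨t, ht⟩ => inducedGame_isSome N ht⟩
  simp [inducedGame, hn] at h

theorem inducedGame_trans_get {a : A} {s : X} (h : ((inducedGame N).R s a).isSome) :
    N.trans a s (((inducedGame N).R s a).get h) := by
  have hex := inducedGame_isSome_iff.1 h
  simpa [inducedGame, hex] using hex.choose_spec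

theorem Normal.isGameStructure (hN : Normal pl pa U N) [Nonempty X] :
    IsGameStructure pl pa (inducedGame N) := by
  obtain ⟨-, -, -, hturn, hinfo, -⟩ := hN
  refine ⟨‹_›, fun s a b ha hb => ?_, fun s a => (hinfo s a).trans inducedGame_isSome_iff.symm⟩
  rw [inducedGame_isSome_iff] at ha hb
  obtain ⟨j, hj⟩ := hturn s ⟨a, ha⟩
  exact (hj a ha).trans (hj b hb).symm

/-- If the state assignment of `M` is a p-morphism into the normal model `N` for the epistemic
relations, then the dynamic semantics on `M` agrees with the temporal semantics on `N`. -/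
theorem Normal.dynSat_iff_etlSat (hN : Normal pl pa U N) (φ : LDEL I A P) :
    ∀ (W : Type) (M : EpiData I A P X W), (∀ w i, M.V w i = N.V (M.f w) i) →
      (∀ i w v, M.sim i w v → N.sim i (M.f w) (M.f v)) →
      (∀ i w t, N.sim i (M.f w) t → ∃ v, M.sim i w v ∧ M.f v = t) →
      ∀ w, dynSat (inducedGame N) U φ W M w ↔ etlSat N φ (M.f w) := by
  induction φ with
  | top => exact fun _ _ _ _ _ _ => Iff.rfl
  | atom p i => exact fun W M hV _ _ w => by simp only [dynSat, etlSat, hV]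
  | neg φ ih => exact fun W M hV hf hb w => not_congr (ih W M hV hf hb w)
  | conj φ ψ ih₁ ih₂ =>
    exact fun W M hV hf hb w => and_congr (ih₁ W M hV hf hb w) (ih₂ W M hV hf hb w)
  | know i φ ih =>
    intro W M hV hf hb w
    simp only [dynSat, etlSat]
    refine ⟨fun h t ht => ?_, fun h v hv => (ih W M hV hf hb v).2 (h _ (hf i w v hv))⟩
    obtain ⟨v, hv, rfl⟩ := hb i w t ht
    exact (ih W M hV hf hb v).1 (h v hv)
  | box a φ ih =>
    intro W M hV hf hb w
    obtain ⟨hnm, hpr, hdet, -, -, hke⟩ := hN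
    have key := ih (UpdW (inducedGame N) M) (update (inducedGame N) U M) (fun _ _ => rfl)
      (fun i x y h => hnm i _ _ _ _ _ _ (hf i _ _ h.1) (inducedGame_trans_get y.prop)
        (inducedGame_trans_get x.prop) h.2.1 h.2.2)
      (by
        intro i x t ht
        obtain ⟨s', b, hs', hab, hb'⟩ := hpr i _ _ _ t (inducedGame_trans_get x.prop) ht
        obtain ⟨v, hv, rfl⟩ := hb i _ _ hs'
        have hget := hdet _ _ _ _
          (inducedGame_trans_get (inducedGame_isSome_iff.2 ⟨t, hb'⟩)) hb'
        refine ⟨⟨(v, b), inducedGame_isSome_iff.2 ⟨t, hb'⟩⟩, ⟨hv, hab, ?_⟩, hget⟩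
        rw [hget]
        exact hke i _ _ ht)
    simp only [dynSat, etlSat]
    refine ⟨fun h t ht => ?_, fun h hs => (key _).2 (h _ (inducedGame_trans_get hs))⟩
    have hs := inducedGame_isSome N ht
    rw [← hdet _ _ _ _ (inducedGame_trans_get hs) ht]
    exact (key ⟨(w, a), hs⟩).1 (h hs)

end InducedGame

section Statements
variable {I A P S W W' : Type}

theorem statement19 [Fintype I] [Fintype A] [Fintype P] [Nonempty I] [Nonempty A]
    (pl : A → I) (pa : A → P) (U : ObsModel I A) (φ : LDEL I A P) :
    SIG pl pa U φ ↔
      ∀ (S : Type) (G : GameData I A P S), IsGameStructure pl pa G →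
        ∀ (W : Type) (M : EpiData I A P S W), IsEpiModel G M →
          ∀ w : W, dynSat G U φ W M w := by
  refine ⟨fun h S G hG W M hM w => h.sound hG hM w, fun h => ?_⟩
  rw [SIG_iff_forall_MCS]
  intro Γ hΓ
  have hN : Normal pl pa U (canonical pl pa U) := canonical_normal
  have : Nonempty (CanW pl pa U) := ⟨⟨Γ, hΓ⟩⟩
  have hsat := h _ _ hN.isGameStructure _ (epiPart (canonical pl pa U))
    ⟨this, canonical_sim_equivalence, hN.2.2.2.2.2, fun _ _ => rfl⟩ ⟨Γ, hΓ⟩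
  rw [hN.dynSat_iff_etlSat φ _ _ (fun _ _ => rfl) (fun _ _ _ hs => hs)
    (fun _ _ t ht => ⟨t, ht, rfl⟩)] at hsat
  exact (etlSat_canonical φ _).1 hsat

end Statements
end GameRuns
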